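/- arXiv:1610.09770 — 2 statements merged into one kernel-verified Lean document; each statement's English description precedes it below -/
import Mathlib

section
/- The multiplicative semigroup (ℤ^d \ {0}, ∗) arising from a proper multiplication ∗ on ℤ^d is left amenable if and only if ∗ is commutative on ℤ^d \ {0}. -/
/-- A proper multiplication on ℤ^d: a biadditive associative operation making
(ℤ^d, +, ∗) a ring without zero divisors. -/
structure ProperMult (d : ℕ) where
  mul : (Fin d → ℤ) → (Fin d → ℤ) → (Fin d → ℤ)
  add_left : ∀ x y z, mul (x + y) z = mul x z + mul y z
  add_right : ∀ x y z, mul x (y + z) = mul x y + mul x z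
  assoc : ∀ x y z, mul (mul x y) z = mul x (mul y z)
  no_zero_divisors : ∀ x y, mul x y = 0 → x = 0 ∨ y = 0

/-- The nonzero integer vectors. -/
def NZ (d : ℕ) : Type := {x : Fin d → ℤ // x ≠ 0}

/-- The multiplication of a proper multiplication, restricted to ℤ^d \ {0}. -/
def pmulNZ {d : ℕ} (P : ProperMult d) (a b : NZ d) : NZ d :=
  ⟨P.mul a.1 b.1, by
    intro h
    rcases P.no_zero_divisors _ _ h with h' | h'
    · exact a.2 h'
    · exact b.2 h'⟩

/-- Left amenability of a (discrete) semigroup, expressed via a left-invariant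
finitely additive probability measure (equivalently, a left-invariant mean on
bounded functions). -/
def HasLeftInvariantMean {S : Type*} (mul : S → S → S) : Prop :=
  ∃ μ : Set S → ℝ, μ Set.univ = 1 ∧ (∀ A : Set S, 0 ≤ μ A) ∧
    (∀ A B : Set S, Disjoint A B → μ (A ∪ B) = μ A + μ B) ∧
    (∀ (s : S) (A : Set S), μ {x : S | mul s x ∈ A} = μ A)

section InvariantMean

open Filter Topology

/-- A finitely additive probability measure on all subsets of `X`. -/
structure IsFinAddProb {X : Type*} (μ : Set X → ℝ) : Prop where
  univ : μ Set.univ = 1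
  nonneg : ∀ A, 0 ≤ μ A
  union : ∀ A B, Disjoint A B → μ (A ∪ B) = μ A + μ B

namespace IsFinAddProb

variable {X : Type*} {μ : Set X → ℝ}

theorem mono (h : IsFinAddProb μ) {A B : Set X} (hAB : A ⊆ B) : μ A ≤ μ B := by
  have h1 := h.union A (B \ A) Set.disjoint_sdiff_right
  rw [Set.union_sdiff_cancel hAB] at h1
  linarith [h.nonneg (B \ A)]

theorem le_one (h : IsFinAddProb μ) (A : Set X) : μ A ≤ 1 :=
  h.univ ▸ h.mono (Set.subset_univ A)

theorem union_le (h : IsFinAddProb μ) (A B : Set X) : μ (A ∪ B) ≤ μ A + μ B := by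
  have h1 := h.union A (B \ A) Set.disjoint_sdiff_right
  rw [Set.union_sdiff_self] at h1
  linarith [h.mono (Set.sdiff_subset : B \ A ⊆ B)]

theorem empty (h : IsFinAddProb μ) : μ ∅ = 0 := by
  have := h.union ∅ ∅ (by simp)
  simp only [Set.union_self] at this
  linarith

theorem biUnion_eq_zero (h : IsFinAddProb μ) {ι : Type*} (s : Finset ι) (A : ι → Set X)
    (hA : ∀ i ∈ s, μ (A i) = 0) : μ (⋃ i ∈ s, A i) = 0 := by
  classical
  induction s using Finset.induction_on with
  | empty => simpa using h.empty
  | insert i s _ ih =>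
    rw [Finset.set_biUnion_insert]
    refine le_antisymm ((h.union_le _ _).trans ?_) (h.nonneg _)
    rw [hA i (Finset.mem_insert_self i s), ih fun j hj => hA j (Finset.mem_insert_of_mem hj)]
    simp

/-- If a measure-preserving map sends `A ∪ B` into `B`, then `A \ B` is null. -/
theorem eq_zero_of_mapsTo (h : IsFinAddProb μ) {φ : X → X} {A B : Set X}
    (hφ : μ (φ ⁻¹' B) = μ B) (hA : A ⊆ φ ⁻¹' B) (hB : B ⊆ φ ⁻¹' B) (hAB : Disjoint B A) :
    μ A = 0 := by
  have h1 := h.mono (Set.union_subset hB hA)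
  rw [h.union B A hAB, hφ] at h1
  linarith [h.nonneg A]

theorem exists_tendsto {ι : Type*} (U : Ultrafilter ι) (ν : ι → Set X → ℝ)
    (hν : ∀ i, IsFinAddProb (ν i)) :
    ∃ μ : Set X → ℝ, IsFinAddProb μ ∧ ∀ A, Tendsto (fun i => ν i A) U (𝓝 (μ A)) := by
  have key : ∀ A, ∃ l, Tendsto (fun i => ν i A) U (𝓝 l) := fun A => by
    obtain ⟨l, -, hl⟩ := (isCompact_Icc (a := (0 : ℝ)) (b := 1)).ultrafilter_le_nhds
      (U.map fun i => ν i A) (by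
        refine le_principal_iff.2 (Filter.mem_map.2 (Filter.univ_mem' fun i => ?_))
        exact ⟨(hν i).nonneg A, (hν i).le_one A⟩)
    exact ⟨l, hl⟩
  choose μ hμ using key
  refine ⟨μ, ⟨?_, fun A => ?_, fun A B hAB => ?_⟩, hμ⟩
  · exact tendsto_nhds_unique (hμ _) (by simp [(hν _).univ])
  · exact ge_of_tendsto' (hμ A) fun i => (hν i).nonneg A
  · refine tendsto_nhds_unique (hμ _) (((hμ A).add (hμ B)).congr fun i => ?_)
    exact ((hν i).union A B hAB).symm

theorem dirac (x : X) : IsFinAddProb fun A : Set X => A.indicator (1 : X → ℝ) x where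
  univ := by simp
  nonneg A := Set.indicator_nonneg (by simp) x
  union A B hAB := by rw [Set.indicator_union_of_disjoint hAB]

theorem comap (h : IsFinAddProb μ) (φ : X → X) : IsFinAddProb fun A => μ (φ ⁻¹' A) where
  univ := h.univ
  nonneg _ := h.nonneg _
  union _ _ hAB := h.union _ _ (hAB.preimage φ)

theorem cesaro (h : IsFinAddProb μ) (φ : X → X) (n : ℕ) :
    IsFinAddProb fun A => (n + 1 : ℝ)⁻¹ * ∑ i ∈ Finset.range (n + 1), μ (φ^[i] ⁻¹' A) where
  univ := by
    simp only [Set.preimage_univ, h.univ, Finset.sum_const, Finset.card_range, nsmul_eq_mul]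
    push_cast
    field_simp
  nonneg _ := mul_nonneg (by positivity) (Finset.sum_nonneg fun i _ => h.nonneg _)
  union A B hAB := by
    simp only [(h.comap _).union A B hAB, Finset.sum_add_distrib, mul_add]

theorem exists_invariant_insert (h : IsFinAddProb μ) (φ : X → X) :
    ∃ μ' : Set X → ℝ, IsFinAddProb μ' ∧ (∀ A, μ' (φ ⁻¹' A) = μ' A) ∧
      ∀ ψ : X → X, Function.Commute ψ φ → (∀ A, μ (ψ ⁻¹' A) = μ A) →
        ∀ A, μ' (ψ ⁻¹' A) = μ' A := by
  obtain ⟨μ', hμ', hlim⟩ := exists_tendsto (hyperfilter ℕ) _ (h.cesaro φ)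
  refine ⟨μ', hμ', fun A => ?_, fun ψ hψ hinv A => ?_⟩
  · have hz : Tendsto (fun n : ℕ => (n + 1 : ℝ)⁻¹ * ∑ i ∈ Finset.range (n + 1),
        μ (φ^[i] ⁻¹' (φ ⁻¹' A)) - (n + 1 : ℝ)⁻¹ * ∑ i ∈ Finset.range (n + 1), μ (φ^[i] ⁻¹' A))
        (hyperfilter ℕ) (𝓝 0) := by
      have hb : Tendsto (fun n : ℕ => (n + 1 : ℝ)⁻¹) (hyperfilter ℕ) (𝓝 0) := by
        refine Tendsto.mono_left ?_ Nat.hyperfilter_le_atTop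
        simpa [one_div] using tendsto_one_div_add_atTop_nhds_zero_nat (𝕜 := ℝ)
      refine squeeze_zero_norm (fun n => ?_) hb
      rw [← mul_sub, ← Finset.sum_sub_distrib]
      have : ∀ i, μ (φ^[i] ⁻¹' (φ ⁻¹' A)) = μ (φ^[i + 1] ⁻¹' A) := fun i => by
        rw [← Set.preimage_comp, Function.iterate_succ']
      simp only [this]
      rw [Finset.sum_range_sub fun i => μ (φ^[i] ⁻¹' A), Real.norm_eq_abs, abs_mul,
        abs_of_nonneg (by positivity : (0 : ℝ) ≤ (n + 1 : ℝ)⁻¹)]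
      refine mul_le_of_le_one_right (by positivity) (abs_sub_le_iff.2 ⟨?_, ?_⟩) <;>
        linarith [h.nonneg (φ^[n + 1] ⁻¹' A), h.nonneg (φ^[0] ⁻¹' A),
          h.le_one (φ^[n + 1] ⁻¹' A), h.le_one (φ^[0] ⁻¹' A)]
    exact sub_eq_zero.1 (tendsto_nhds_unique ((hlim _).sub (hlim A)) hz)
  · refine tendsto_nhds_unique (hlim _) ((hlim A).congr fun n => ?_)
    congr 1
    refine Finset.sum_congr rfl fun i _ => ?_
    rw [← hinv, ← Set.preimage_comp, ← Set.preimage_comp, (hψ.iterate_right i).comp_eq]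

/-- A pairwise commuting family of self-maps of a nonempty type has a common invariant
finitely additive probability measure. -/
theorem exists_invariant_of_commute [Nonempty X] {S : Type*} (φ : S → X → X)
    (hφ : ∀ s t, Function.Commute (φ s) (φ t)) :
    ∃ μ : Set X → ℝ, IsFinAddProb μ ∧ ∀ s A, μ (φ s ⁻¹' A) = μ A := by
  classical
  have fin : ∀ F : Finset S, ∃ μ : Set X → ℝ, IsFinAddProb μ ∧
      ∀ s ∈ F, ∀ A, μ (φ s ⁻¹' A) = μ A := fun F => by
    induction F using Finset.induction_on with
    | empty => exact ⟨_, dirac (Classical.arbitrary X), by simp⟩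
    | insert s F _ ih =>
      obtain ⟨μ, hμ, hF⟩ := ih
      obtain ⟨μ', hμ', hs, hc⟩ := hμ.exists_invariant_insert (φ s)
      refine ⟨μ', hμ', fun t ht => ?_⟩
      rcases Finset.mem_insert.1 ht with rfl | ht
      · exact hs
      · exact hc _ (hφ t s) (hF t ht)
  choose ν hν hinv using fin
  obtain ⟨μ, hμ, hlim⟩ := exists_tendsto (Ultrafilter.of (atTop : Filter (Finset S))) ν hν
  refine ⟨μ, hμ, fun s A => tendsto_nhds_unique (hlim _) ((hlim A).congr' ?_)⟩
  filter_upwards [Ultrafilter.of_le _ (eventually_ge_atTop {s})] with F hF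
  exact (hinv F s (hF (Finset.mem_singleton_self s)) A).symm

end IsFinAddProb

end InvariantMean

section PadicRoot

open Polynomial

/-- For a nonconstant integer polynomial with nonzero constant term, some value is divisible by a
prime not dividing a given nonzero integer. -/
theorem Polynomial.exists_prime_dvd_eval_not_dvd (g : ℤ[X]) (hg : 0 < g.natDegree)
    (h0 : g.eval 0 ≠ 0) (c : ℤ) (hc : c ≠ 0) :
    ∃ (p : ℕ) (m : ℤ), p.Prime ∧ (p : ℤ) ∣ g.eval m ∧ ¬ (p : ℤ) ∣ c := by
  set b := g.eval 0 with hb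
  have hne : ∀ e : ℤ, g - C e ≠ 0 := fun e h => by
    rw [sub_eq_zero.1 h, natDegree_C] at hg
    exact hg.false
  obtain ⟨k, hk⟩ : ∃ k : ℤ, b * c * k ∉
      (((g - C b) * (g - C (-b))).roots.toFinset : Set ℤ) := by
    have hinj : Function.Injective fun k : ℤ => b * c * k :=
      mul_right_injective₀ (mul_ne_zero h0 hc)
    obtain ⟨_, ⟨k, rfl⟩, hk⟩ := (Set.infinite_range_of_injective hinj).exists_notMem_finset
      ((g - C b) * (g - C (-b))).roots.toFinset
    exact ⟨k, hk⟩
  simp only [Multiset.mem_toFinset, Finset.mem_coe, mem_roots (mul_ne_zero (hne b) (hne (-b))),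
    IsRoot.def, eval_mul, eval_sub, eval_C, mul_eq_zero, not_or, sub_eq_zero] at hk
  obtain ⟨q, hq⟩ : b * c * k ∣ g.eval (b * c * k) - b := by
    simpa using g.sub_dvd_eval_sub (b * c * k) 0
  have hval : g.eval (b * c * k) = b * (1 + c * (k * q)) := by linear_combination hq
  have hu : (1 + c * (k * q)).natAbs ≠ 1 := fun h => by
    rcases Int.natAbs_eq_iff.1 h with h | h <;> rw [h] at hval <;> simp at hval <;> grind
  obtain ⟨p, hp, hpd⟩ := Int.exists_prime_and_dvd hu
  refine ⟨p.natAbs, b * c * k, Int.prime_iff_natAbs_prime.1 hp, ?_, fun h => ?_⟩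
  · rw [Int.natAbs_dvd, hval]
    exact hpd.mul_left b
  · rw [Int.natAbs_dvd] at h
    exact hp.not_isUnit (isUnit_of_dvd_one ((dvd_add_left (h.mul_right _)).1 hpd))

/-- An irreducible rational polynomial has a root in some field of `p`-adic numbers. -/
theorem Polynomial.exists_padic_root (f : ℚ[X]) (hf : Irreducible f) :
    ∃ (p : ℕ) (_ : Fact p.Prime) (r : ℚ_[p]), aeval r f = 0 := by
  obtain ⟨b, hb, hbf⟩ := IsLocalization.integerNormalization_spec (nonZeroDivisors ℤ) f
  set g := IsLocalization.integerNormalization (nonZeroDivisors ℤ) f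
  have hb0 : b ≠ 0 := nonZeroDivisors.ne_zero hb
  have hgf : g.map (algebraMap ℤ ℚ) = C (b : ℚ) * f := by
    rw [hbf, ← smul_eq_C_mul]; ext; simp
  have hbQ : (b : ℚ) ≠ 0 := by exact_mod_cast hb0
  have hroot : ∀ (p : ℕ) [Fact p.Prime] (r : ℚ_[p]), aeval r g = 0 → aeval r f = 0 := by
    intro p _ r hr
    have h1 := aeval_map_algebraMap ℚ r g
    rw [hgf, hr, map_mul, aeval_C] at h1
    exact (mul_eq_zero.1 h1).resolve_left (by simpa using hb0)
  by_cases h0 : g.eval 0 = 0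
  · refine ⟨2, ⟨Nat.prime_two⟩, 0, hroot 2 0 ?_⟩
    rw [aeval_def, eval₂_at_zero, ← coeff_zero_eq_eval_zero] at *
    simp [h0]
  have hsep : (g.map (algebraMap ℤ ℚ)).Separable := by
    rw [hgf]
    exact hf.separable.unit_mul (isUnit_C.2 hbQ.isUnit)
  obtain ⟨u, w, huw⟩ := hsep
  obtain ⟨e, he, hu⟩ := IsLocalization.integerNormalization_spec (nonZeroDivisors ℤ) u
  obtain ⟨e', he', hw⟩ := IsLocalization.integerNormalization_spec (nonZeroDivisors ℤ) w
  set U := IsLocalization.integerNormalization (nonZeroDivisors ℤ) u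
  set W := IsLocalization.integerNormalization (nonZeroDivisors ℤ) w
  have hbez : C e' * U * g + C e * W * derivative g = C (e * e') := by
    apply map_injective (algebraMap ℤ ℚ) (algebraMap ℤ ℚ).injective_int
    have hu' : U.map (algebraMap ℤ ℚ) = C (e : ℚ) * u := by
      rw [hu, ← smul_eq_C_mul]; ext; simp
    have hw' : W.map (algebraMap ℤ ℚ) = C (e' : ℚ) * w := by
      rw [hw, ← smul_eq_C_mul]; ext; simp
    simp only [Polynomial.map_add, Polynomial.map_mul, map_C, hu', hw', ← derivative_map]
    simp only [eq_intCast, map_mul]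
    linear_combination (C (e : ℚ) * C (e' : ℚ)) * huw
  have hdeg : 0 < g.natDegree := by
    rw [← natDegree_map_eq_of_injective (algebraMap ℤ ℚ).injective_int g, hgf,
      natDegree_C_mul hbQ]
    exact hf.natDegree_pos
  obtain ⟨p, m, hp, hpm, hpc⟩ := exists_prime_dvd_eval_not_dvd g hdeg h0 (e * e')
    (mul_ne_zero (nonZeroDivisors.ne_zero he) (nonZeroDivisors.ne_zero he'))
  have : Fact p.Prime := ⟨hp⟩
  have hd : ¬ (p : ℤ) ∣ (derivative g).eval m := fun h => hpc <| by
    have := congrArg (eval m) hbez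
    simp only [eval_add, eval_mul, eval_C] at this
    rw [← this]
    exact (hpm.mul_left _).add (h.mul_left _)
  have hev : ∀ q : ℤ[X], aeval (m : ℤ_[p]) q = ((q.eval m : ℤ) : ℤ_[p]) := fun q => by
    simpa using aeval_algebraMap_apply (A := ℤ) ℤ_[p] m q
  obtain ⟨z, hz, -⟩ := hensels_lemma (F := g) (a := (m : ℤ_[p])) (by
    rw [hev, hev]
    have h1 : ‖(((derivative g).eval m : ℤ) : ℤ_[p])‖ = 1 :=
      le_antisymm (PadicInt.norm_le_one _)
        (not_lt.1 fun h => hd ((PadicInt.norm_int_lt_one_iff_dvd _).1 h))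
    rw [h1, one_pow]
    exact (PadicInt.norm_int_lt_one_iff_dvd _).2 hpm)
  refine ⟨p, ⟨hp⟩, z, hroot p z ?_⟩
  have := aeval_algebraMap_apply ℚ_[p] z g
  rw [hz, map_zero] at this
  exact this

end PadicRoot

/-- A norm on a vector space over `K`, with respect to the absolute value induced by an embedding
`σ` of `K` in a normed field, for which all endomorphisms are bounded. -/
structure IsGauge {K Ω V : Type*} [Field K] [NormedField Ω] [AddCommGroup V] [Module K V]
    (σ : K →+* Ω) (N : V → ℝ) : Prop where
  nonneg : ∀ x, 0 ≤ N x
  add_le : ∀ x y, N (x + y) ≤ N x + N y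
  smul : ∀ (k : K) x, N (k • x) = ‖σ k‖ * N x
  eq_zero : ∀ x, N x = 0 → x = 0
  bound : ∀ T : Module.End K V, ∃ C > 0, ∀ x, N (T x) ≤ C * N x

section Gauge

variable {K Ω V : Type*} [Field K] [NormedField Ω] [AddCommGroup V] [Module K V] {σ : K →+* Ω}
  {N : V → ℝ}

theorem exists_isGauge [FiniteDimensional K V] (σ : K →+* Ω) : ∃ N : V → ℝ, IsGauge σ N := by
  let b := Module.finBasis K V
  have hadd : ∀ x y : V, ∑ i, ‖σ (b.repr (x + y) i)‖ ≤
      ∑ i, ‖σ (b.repr x i)‖ + ∑ i, ‖σ (b.repr y i)‖ := fun x y => by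
    rw [← Finset.sum_add_distrib]
    exact Finset.sum_le_sum fun i _ => by simpa using norm_add_le _ _
  have hsmul : ∀ (k : K) (x : V), ∑ i, ‖σ (b.repr (k • x) i)‖ =
      ‖σ k‖ * ∑ i, ‖σ (b.repr x i)‖ := fun k x => by
    simp [Finset.mul_sum]
  refine ⟨fun x => ∑ i, ‖σ (b.repr x i)‖, fun x => by positivity, hadd, hsmul,
    fun x hx => ?_, fun T => ?_⟩
  · rw [Finset.sum_eq_zero_iff_of_nonneg fun _ _ => norm_nonneg _] at hx
    refine b.repr.map_eq_zero_iff.1 (Finsupp.ext fun i => ?_)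
    simpa using hx i (Finset.mem_univ i)
  · set N : V → ℝ := fun x => ∑ i, ‖σ (b.repr x i)‖
    have hN : ∀ x, 0 ≤ N x := fun x => by positivity
    have hsum : ∀ (s : Finset (Fin (Module.finrank K V))) (v : Fin (Module.finrank K V) → V),
        N (∑ i ∈ s, v i) ≤ ∑ i ∈ s, N (v i) := fun s v =>
      Finset.le_sum_of_subadditive N (by simp [N]) hadd s v
    refine ⟨∑ i, N (T (b i)) + 1, add_pos_of_nonneg_of_pos (Finset.sum_nonneg fun i _ => hN _)
      one_pos, fun x => ?_⟩
    calc N (T x) = N (∑ i, b.repr x i • T (b i)) := by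
            conv_lhs => rw [← b.sum_repr x, map_sum]
            simp only [map_smul]
      _ ≤ ∑ i, N (b.repr x i • T (b i)) := hsum _ _
      _ = ∑ i, ‖σ (b.repr x i)‖ * N (T (b i)) := by simp only [N, hsmul]
      _ ≤ ∑ i, ‖σ (b.repr x i)‖ * (∑ i, N (T (b i)) + 1) := by
            gcongr with i
            linarith [Finset.single_le_sum (fun i _ => hN (T (b i))) (Finset.mem_univ i)]
      _ = _ := by rw [← Finset.sum_mul, mul_comm]

theorem IsGauge.pos (hN : IsGauge σ N) {x : V} (hx : x ≠ 0) : 0 < N x :=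
  (hN.nonneg x).lt_of_ne fun h => hx (hN.eq_zero x h.symm)

/-- A finite family of endomorphisms with trivial common kernel is jointly bounded below. -/
theorem IsGauge.exists_le_of_iInf_ker_eq_bot (hN : IsGauge σ N) (Φ : Finset (Module.End K V))
    (hΦ : ⨅ φ ∈ Φ, LinearMap.ker φ = ⊥) :
    ∃ s > 0, ∀ x ≠ 0, ∃ φ ∈ Φ, s * N x < N (φ x) := by
  classical
  let F : V →ₗ[K] (Φ → V) := LinearMap.pi fun φ => φ.1
  have hF : LinearMap.ker F = ⊥ := by
    rw [LinearMap.ker_pi, ← hΦ, iInf_subtype]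
  obtain ⟨G, hG⟩ := F.exists_leftInverse_of_injective hF
  choose C hC hCb using fun φ : Φ => hN.bound (G ∘ₗ LinearMap.single K (fun _ => V) φ)
  have hS : 0 < ∑ φ, C φ + 1 := add_pos_of_nonneg_of_pos (Finset.sum_nonneg fun i _ => (hC i).le)
    one_pos
  refine ⟨(∑ φ, C φ + 1)⁻¹, inv_pos.2 hS, fun x hx => ?_⟩
  by_contra! hcon
  have hx' : x = ∑ φ : Φ, G (Pi.single φ (φ.1 x)) := by
    rw [← map_sum]
    change x = G (∑ φ, Pi.single φ (F x φ))
    rw [Finset.univ_sum_single (F x)]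
    exact (LinearMap.congr_fun hG x).symm
  have h0 : N 0 = 0 := by simpa using hN.smul 0 0
  have : N x ≤ ∑ φ, C φ * ((∑ φ, C φ + 1)⁻¹ * N x) := by
    conv_lhs => rw [hx']
    refine (Finset.le_sum_of_subadditive N h0.le hN.add_le _ _).trans
      (Finset.sum_le_sum fun φ _ => (hCb φ (φ.1 x)).trans ?_)
    exact mul_le_mul_of_nonneg_left (hcon φ.1 φ.2) (hC φ).le
  rw [← Finset.sum_mul, ← mul_assoc, ← div_eq_mul_inv] at this
  have hlt : (∑ φ, C φ) / (∑ φ, C φ + 1) < 1 := (div_lt_one hS).2 (lt_add_one _)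
  nlinarith [hN.pos hx]

/-- Let `π` be an endomorphism such that every nonzero vector can be moved by some `Λ i` off both
`ker π` and `ker (1 - π)`. Then finitely many `Λ i` suffice to move every nonzero vector
quantitatively away from both kernels. -/
theorem IsGauge.exists_finset_away [FiniteDimensional K V] (hN : IsGauge σ N)
    (π : Module.End K V) {ι : Type*} (Λ : ι → Module.End K V)
    (hΛ : ∀ w ≠ 0, ∃ i, π (Λ i w) ≠ 0 ∧ Λ i w - π (Λ i w) ≠ 0) :
    ∃ (H : Finset ι) (s : ℝ), 0 < s ∧ ∀ x ≠ 0, ∃ i ∈ H,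
      s * N (Λ i x - π (Λ i x)) ≤ N (π (Λ i x)) ∧ s * N (π (Λ i x)) ≤ N (Λ i x - π (Λ i x)) := by
  classical
  have key : ∀ (n : ℕ) (Φ : Finset (Module.End K V)),
      Module.finrank K (⨅ φ ∈ Φ, LinearMap.ker φ : Submodule K V) = n →
      ∃ (H : Finset ι) (s : ℝ), 0 < s ∧ ∀ x ≠ 0, (∀ φ ∈ Φ, N (φ x) ≤ s * N x) → ∃ i ∈ H,
        s * N (Λ i x - π (Λ i x)) ≤ N (π (Λ i x)) ∧
          s * N (π (Λ i x)) ≤ N (Λ i x - π (Λ i x)) := by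
    intro n
    induction n using Nat.strong_induction_on with
    | _ n ih =>
      intro Φ hΦ
      by_cases hbot : (⨅ φ ∈ Φ, LinearMap.ker φ) = ⊥
      · obtain ⟨s, hs, h⟩ := hN.exists_le_of_iInf_ker_eq_bot Φ hbot
        refine ⟨∅, s, hs, fun x hx hle => ?_⟩
        obtain ⟨φ, hφ, hlt⟩ := h x hx
        exact absurd (hle φ hφ) hlt.not_ge
      · obtain ⟨w, hw, hw0⟩ := Submodule.exists_mem_ne_zero_of_ne_bot hbot
        obtain ⟨i, hi1, hi2⟩ := hΛ w hw0
        have step : ∀ ψ : Module.End K V, ψ w ≠ 0 → ∃ (H : Finset ι) (s : ℝ), 0 < s ∧ ∀ x ≠ 0,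
            (∀ φ ∈ insert ψ Φ, N (φ x) ≤ s * N x) → ∃ i ∈ H,
              s * N (Λ i x - π (Λ i x)) ≤ N (π (Λ i x)) ∧
                s * N (π (Λ i x)) ≤ N (Λ i x - π (Λ i x)) := fun ψ hψ => by
          refine ih _ ?_ (insert ψ Φ) rfl
          rw [← hΦ, Finset.iInf_insert]
          refine Submodule.finrank_lt_finrank_of_lt (lt_of_le_of_ne inf_le_right fun h => hψ ?_)
          rw [← h] at hw
          exact (Submodule.mem_inf.1 hw).1
        obtain ⟨H₁, s₁, hs₁, h₁⟩ := step (π * Λ i) hi1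
        obtain ⟨H₂, s₂, hs₂, h₂⟩ := step (Λ i - π * Λ i) hi2
        obtain ⟨C₁, hC₁, hb₁⟩ := hN.bound (π * Λ i)
        obtain ⟨C₂, hC₂, hb₂⟩ := hN.bound (Λ i - π * Λ i)
        simp only [LinearMap.sub_apply, Module.End.mul_apply] at hb₁ hb₂
        have hpos : 0 < min s₁ s₂ := lt_min hs₁ hs₂
        have hC : 0 < 1 + C₁ + C₂ := by positivity
        set s := min s₁ s₂ / (1 + C₁ + C₂) with hs
        have hs0 : 0 < s := div_pos hpos hC
        have hsmin : s * (1 + C₁ + C₂) = min s₁ s₂ := div_mul_cancel₀ _ hC.ne'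
        have hss : s ≤ min s₁ s₂ := by nlinarith
        have hss₁ : s ≤ s₁ := hss.trans (min_le_left _ _)
        have hss₂ : s ≤ s₂ := hss.trans (min_le_right _ _)
        have hsC₂ : s * C₂ ≤ s₁ := by nlinarith [min_le_left s₁ s₂]
        have hsC₁ : s * C₁ ≤ s₂ := by nlinarith [min_le_right s₁ s₂]
        refine ⟨insert i (H₁ ∪ H₂), s, hs0, fun x hx hle => ?_⟩
        have hx0 := hN.nonneg x
        by_cases hA : s * N (Λ i x - π (Λ i x)) ≤ N (π (Λ i x))
        · by_cases hB : s * N (π (Λ i x)) ≤ N (Λ i x - π (Λ i x))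
          · exact ⟨i, Finset.mem_insert_self _ _, hA, hB⟩
          · obtain ⟨k, hk, hk1, hk2⟩ := h₂ x hx fun φ hφ => by
              rcases Finset.mem_insert.1 hφ with rfl | hφ
              · simp only [LinearMap.sub_apply, Module.End.mul_apply]
                nlinarith [hb₁ x]
              · nlinarith [hle φ hφ]
            refine ⟨k, by simp [hk], ?_, ?_⟩
            · exact (mul_le_mul_of_nonneg_right hss₂ (hN.nonneg _)).trans hk1
            · exact (mul_le_mul_of_nonneg_right hss₂ (hN.nonneg _)).trans hk2
        · obtain ⟨k, hk, hk1, hk2⟩ := h₁ x hx fun φ hφ => by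
            rcases Finset.mem_insert.1 hφ with rfl | hφ
            · simp only [Module.End.mul_apply]
              nlinarith [hb₂ x]
            · nlinarith [hle φ hφ]
          refine ⟨k, by simp [hk], ?_, ?_⟩
          · exact (mul_le_mul_of_nonneg_right hss₁ (hN.nonneg _)).trans hk1
          · exact (mul_le_mul_of_nonneg_right hss₁ (hN.nonneg _)).trans hk2
  obtain ⟨H, s, hs, h⟩ := key _ ∅ rfl
  exact ⟨H, s, hs, fun x hx => h x hx (by simp)⟩

/-- If `π` is a projection onto `ker B` along an invariant complement, then for small `ε` the map
`B + ε` contracts the range of `π` relative to the complement. -/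
theorem IsGauge.exists_contraction (hN : IsGauge σ N) {B Q π : Module.End K V}
    (hBπ : B * π = 0) (hπB : π * B = 0) (hQ : 1 - π = Q * B) :
    ∃ C > 0, ∀ ε : K, ‖σ ε‖ * C ≤ 1 → ∀ x,
      N (π (B x + ε • x)) = ‖σ ε‖ * N (π x) ∧
        N (x - π x) ≤ C * N (B x + ε • x - π (B x + ε • x)) := by
  obtain ⟨C, hC, hb⟩ := hN.bound Q
  have h1 : ∀ x, B (π x) = 0 := LinearMap.congr_fun hBπ
  have h2 : ∀ x, π (B x) = 0 := LinearMap.congr_fun hπB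
  have h3 : ∀ x, x - π x = Q (B x) := LinearMap.congr_fun hQ
  refine ⟨2 * C, by positivity, fun ε hε x => ⟨?_, ?_⟩⟩
  · rw [map_add, h2, zero_add, map_smul, hN.smul]
  · have h4 : B x + ε • x - π (B x + ε • x) = B x + ε • (x - π x) := by
      rw [map_add, h2, map_smul, smul_sub]
      abel
    rw [h4]
    have h5 : N (B x) ≤ N (B x + ε • (x - π x)) + ‖σ ε‖ * N (x - π x) := by
      have := hN.add_le (B x + ε • (x - π x)) ((-ε) • (x - π x))
      rw [neg_smul, add_neg_cancel_right, ← neg_smul, hN.smul, map_neg, norm_neg] at this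
      exact this
    have h6 := hb (B x)
    rw [← h3] at h6
    nlinarith [hN.nonneg (x - π x)]

end Gauge

section Nonamenable

open Polynomial

/-- Nonamenability criterion for a semigroup of nonzero elements of a division ring `D` that is a
vector space over a field `K` commuting with left multiplications: some noncentral `a : D` should
act with an eigenvalue `r : K` which is a simple root of a polynomial annihilating it, and which is
a limit of central scalars. -/
theorem not_hasLeftInvariantMean_of_simple_root {D K Ω S : Type*} [DivisionRing D] [Field K]
    [NormedField Ω] [Module K D] [SMulCommClass K D D] [FiniteDimensional K D] [CharZero K]
    (σ : K →+* Ω) {a : D} {r : K} (ha : a = r • (1 : D)) {z : D} (hz : a * z ≠ r • z)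
    {g : K[X]} (hg : aeval (LinearMap.mulLeft K a) ((X - C r) * g) = 0) (hgr : g.eval r ≠ 0)
    (hdense : ∀ δ > 0, ∃ m : K, (∀ x : D, (m • (1 : D)) * x = m • x) ∧ ‖σ (r - m)‖ < δ)
    {mul : S → S → S} {j : S → D} (hmul : ∀ s t, j (mul s t) = j s * j t) (hj : ∀ s, j s ≠ 0)
    (hfrac : ∀ y : D, y ≠ 0 → ∃ (n : ℕ) (s : S), n ≠ 0 ∧ j s = n • y) :
    ¬ HasLeftInvariantMean mul := by
  rintro ⟨μ, h1, h2, h3, hinv⟩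
  have hμ : IsFinAddProb μ := ⟨h1, h2, h3⟩
  set T : Module.End K D := LinearMap.mulLeft K a with hT
  set B : Module.End K D := aeval T (X - C r) with hB
  set π : Module.End K D := aeval T (C (g.eval r)⁻¹ * g) with hπ
  have hBx : ∀ x, B x = a * x - r • x := fun x => by
    simp [hB, hT]
  obtain ⟨q, hq⟩ : X - C r ∣ 1 - C (g.eval r)⁻¹ * g := by
    rw [dvd_iff_isRoot, IsRoot.def]
    simp [hgr]
  have hBπ : B * π = 0 := by
    rw [hB, hπ, ← map_mul, mul_left_comm, map_mul, hg, mul_zero]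
  have hπB : π * B = 0 := by
    rw [hB, hπ, ← map_mul, mul_comm, mul_left_comm, map_mul, hg, mul_zero]
  have hQ : 1 - π = aeval T q * B := by
    rw [hB, hπ, ← map_mul, mul_comm q, ← hq, map_sub, map_one]
  have hxQ : ∀ x, x - π x = aeval T q (B x) := LinearMap.congr_fun hQ
  have hone : π 1 = 1 := by
    have := hxQ 1
    rw [hBx, mul_one, ha, sub_self, map_zero, sub_eq_zero] at this
    exact this.symm
  have hz' : z - π z ≠ 0 := fun h => hz <| by
    have : B (π z) = 0 := LinearMap.congr_fun hBπ z
    rwa [← sub_eq_zero.1 h, hBx, sub_eq_zero] at this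
  have hππ : π (z - π z) = 0 := by
    rw [map_sub, sub_eq_zero]
    have h4 := hxQ (π z)
    have : B (π z) = 0 := LinearMap.congr_fun hBπ z
    rw [this, map_zero, sub_eq_zero] at h4
    exact h4
  obtain ⟨N, hN⟩ := exists_isGauge (V := D) σ
  obtain ⟨H, s, hs, hH⟩ := hN.exists_finset_away π (fun t : S => LinearMap.mulLeft K (j t))
    fun w hw => by
      have hy : (1 + (z - π z)) * w⁻¹ ≠ 0 := mul_ne_zero (fun h => by
        have := congrArg π h
        rw [map_add, hone, hππ, map_zero, add_zero] at this
        exact one_ne_zero this) (inv_ne_zero hw)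
      obtain ⟨n, t, hn, ht⟩ := hfrac _ hy
      have htw : j t * w = (n : K) • (1 + (z - π z)) := by
        rw [ht, smul_mul_assoc, inv_mul_cancel_right₀ hw, Nat.cast_smul_eq_nsmul]
      have hnK : (n : K) ≠ 0 := Nat.cast_ne_zero.2 hn
      refine ⟨t, ?_, ?_⟩
      · rw [LinearMap.mulLeft_apply, htw, map_smul, map_add, hone, hππ, add_zero]
        exact smul_ne_zero hnK one_ne_zero
      · rw [LinearMap.mulLeft_apply, htw, map_smul, map_add, hone, hππ, add_zero, ← smul_sub,
          add_sub_cancel_left]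
        exact smul_ne_zero hnK hz'
  simp only [LinearMap.mulLeft_apply] at hH
  obtain ⟨C, hC, hcon⟩ := hN.exists_contraction hBπ hπB hQ
  obtain ⟨m, hm, hmδ⟩ := hdense (min 1 (s ^ 2) / C) (by positivity)
  rw [lt_div_iff₀ hC, lt_min_iff] at hmδ
  obtain ⟨hm1, hms⟩ := hmδ
  have ham : a - m • (1 : D) ≠ 0 := fun h => hz <| by
    rw [sub_eq_zero.1 h, hm]
    rw [ha, ← sub_smul, smul_eq_zero, sub_eq_zero] at h
    rw [h.resolve_right one_ne_zero]
  obtain ⟨n, t, hn, ht⟩ := hfrac _ ham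
  have hnσ : 0 < ‖σ n‖ := norm_pos_iff.2 ((map_ne_zero σ).2 (Nat.cast_ne_zero.2 hn))
  have htx : ∀ x, j t * x = (n : K) • (B x + (r - m) • x) := fun x => by
    rw [ht, smul_mul_assoc, sub_mul, hm, hBx, sub_smul, Nat.cast_smul_eq_nsmul]
    congr 1
    abel
  have hP : ∀ x, N (π (j t * x)) = ‖σ n‖ * (‖σ (r - m)‖ * N (π x)) := fun x => by
    rw [htx, map_smul, hN.smul, (hcon _ hm1.le x).1]
  have hR : ∀ x, ‖σ n‖ * N (x - π x) ≤ C * N (j t * x - π (j t * x)) := fun x => by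
    rw [htx, map_smul, ← smul_sub, hN.smul]
    have := mul_le_mul_of_nonneg_left (hcon _ hm1.le x).2 hnσ.le
    linarith
  set A : Set S := {x | s * N (j x - π (j x)) ≤ N (π (j x)) ∧ s * N (π (j x)) ≤ N (j x - π (j x))}
    with hAdef
  set E : Set S := {x | N (π (j x)) < s * N (j x - π (j x))} with hEdef
  have hA : μ A = 0 := by
    refine hμ.eq_zero_of_mapsTo (hinv t E) (fun x hx => ?_) (fun x hx => ?_) ?_
    · obtain ⟨-, hx⟩ := hx
      have hpos : 0 < N (j x - π (j x)) := by
        refine (hN.nonneg _).lt_of_ne fun h => hj x ?_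
        have hπ0 : N (π (j x)) = 0 := by nlinarith [hN.nonneg (π (j x))]
        rw [← sub_add_cancel (j x) (π (j x)), hN.eq_zero _ h.symm, hN.eq_zero _ hπ0, add_zero]
      have hpos' : 0 < N (j t * j x - π (j t * j x)) := by
        have := (mul_pos hnσ hpos).trans_le (hR (j x))
        exact pos_of_mul_pos_right this hC.le
      simp only [hEdef, Set.mem_preimage, Set.mem_ofPred_eq, hmul]
      refine lt_of_mul_lt_mul_left ?_ hs.le
      calc s * N (π (j t * j x)) = ‖σ (r - m)‖ * (‖σ n‖ * (s * N (π (j x)))) := by rw [hP]; ring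
        _ ≤ ‖σ (r - m)‖ * (‖σ n‖ * N (j x - π (j x))) := by gcongr
        _ ≤ ‖σ (r - m)‖ * (C * N (j t * j x - π (j t * j x))) :=
            mul_le_mul_of_nonneg_left (hR _) (norm_nonneg _)
        _ = ‖σ (r - m)‖ * C * N (j t * j x - π (j t * j x)) := by ring
        _ < s ^ 2 * N (j t * j x - π (j t * j x)) := by gcongr
        _ = _ := by ring
    · have hx : N (π (j x)) < s * N (j x - π (j x)) := hx
      have hpos : 0 < N (j x - π (j x)) :=
        pos_of_mul_pos_right ((hN.nonneg _).trans_lt hx) hs.le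
      have hpos' : 0 < N (j t * j x - π (j t * j x)) := by
        have := (mul_pos hnσ hpos).trans_le (hR (j x))
        exact pos_of_mul_pos_right this hC.le
      simp only [hEdef, Set.mem_preimage, Set.mem_ofPred_eq, hmul]
      calc N (π (j t * j x)) = ‖σ (r - m)‖ * (‖σ n‖ * N (π (j x))) := by rw [hP]; ring
        _ ≤ ‖σ (r - m)‖ * (‖σ n‖ * (s * N (j x - π (j x)))) := by gcongr
        _ = s * (‖σ (r - m)‖ * (‖σ n‖ * N (j x - π (j x)))) := by ring
        _ ≤ s * (‖σ (r - m)‖ * (C * N (j t * j x - π (j t * j x)))) :=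
            mul_le_mul_of_nonneg_left (mul_le_mul_of_nonneg_left (hR _) (norm_nonneg _)) hs.le
        _ = s * (‖σ (r - m)‖ * C * N (j t * j x - π (j t * j x))) := by ring
        _ < s * (1 * N (j t * j x - π (j t * j x))) := by gcongr
        _ = _ := by ring
    · exact Set.disjoint_left.2 fun x hx hx' => hx'.1.not_gt hx
  have hU : (⋃ h ∈ H, {x : S | mul h x ∈ A}) = Set.univ := by
    refine Set.eq_univ_of_forall fun x => ?_
    obtain ⟨h, hh, hx⟩ := hH (j x) (hj x)
    simp only [Set.mem_iUnion]
    refine ⟨h, hh, ?_⟩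
    simpa only [hAdef, Set.mem_ofPred_eq, hmul] using hx
  have := hμ.biUnion_eq_zero H (fun h => {x : S | mul h x ∈ A}) fun h _ => (hinv h A).trans hA
  rw [hU, h1] at this
  exact one_ne_zero this

/-- A multiplicative semigroup spanning a noncommutative finite-dimensional division algebra over
`ℚ` up to denominators is not left amenable. -/
theorem not_hasLeftInvariantMean_of_not_commute {D S : Type*} [DivisionRing D] [Algebra ℚ D]
    [FiniteDimensional ℚ D] {a z : D} (haz : a * z ≠ z * a)
    {mul : S → S → S} {j : S → D} (hmul : ∀ s t, j (mul s t) = j s * j t) (hj : ∀ s, j s ≠ 0)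
    (hfrac : ∀ y : D, y ≠ 0 → ∃ (n : ℕ) (s : S), n ≠ 0 ∧ j s = n • y) :
    ¬ HasLeftInvariantMean mul := by
  have hint : IsIntegral ℚ a := Algebra.IsIntegral.isIntegral a
  set f := minpoly ℚ a with hf
  have hirr : Irreducible f := minpoly.irreducible hint
  have : Fact (Irreducible f) := ⟨hirr⟩
  obtain ⟨p, hp, r', hr'⟩ := exists_padic_root f hirr
  let σ : AdjoinRoot f →+* ℚ_[p] := AdjoinRoot.lift (algebraMap ℚ ℚ_[p]) r' hr'
  have hσr : σ (AdjoinRoot.root f) = r' := AdjoinRoot.lift_root hr'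
  let ψ₀ : ℚ[X] →+* Dᵐᵒᵖ := (aeval (MulOpposite.op a) : ℚ[X] →ₐ[ℚ] Dᵐᵒᵖ).toRingHom
  have hψ₀ : ∀ q : ℚ[X], ψ₀ q = MulOpposite.op (aeval a q) := fun q => by
    induction q using Polynomial.induction_on' with
    | add p q hp hq => rw [map_add, hp, hq, map_add, MulOpposite.op_add]
    | monomial n c =>
      change aeval (MulOpposite.op a) (monomial n c) = _
      rw [aeval_monomial, aeval_monomial, ← Algebra.smul_def, ← Algebra.smul_def,
        ← MulOpposite.op_pow, MulOpposite.op_smul]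
  let ψ : AdjoinRoot f →+* Dᵐᵒᵖ := Ideal.Quotient.lift (Ideal.span {f}) ψ₀ fun q hq => by
    obtain ⟨q, rfl⟩ := Ideal.mem_span_singleton.1 hq
    rw [hψ₀, map_mul, hf, minpoly.aeval, zero_mul, MulOpposite.op_zero]
  have hψ : ∀ q, ψ (AdjoinRoot.mk f q) = MulOpposite.op (aeval a q) := hψ₀
  let : Module (AdjoinRoot f) D := Module.compHom D ψ
  have hsmul : ∀ (q : ℚ[X]) (x : D), AdjoinRoot.mk f q • x = x * aeval a q := fun q x => by
    change ψ (AdjoinRoot.mk f q) • x = _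
    rw [hψ, op_smul_eq_mul]
  have hroot : ∀ x : D, AdjoinRoot.root f • x = x * a := fun x => by
    simpa using hsmul X x
  have hof : ∀ (c : ℚ) (x : D), AdjoinRoot.of f c • x = c • x := fun c x => by
    rw [← AdjoinRoot.mk_C, hsmul, aeval_C, Algebra.smul_def, Algebra.commutes]
  have : SMulCommClass (AdjoinRoot f) D D := ⟨fun k x y => by
    obtain ⟨q, rfl⟩ := AdjoinRoot.mk_surjective k
    rw [hsmul, hsmul, smul_eq_mul, smul_eq_mul, mul_assoc]⟩
  have : IsScalarTower ℚ (AdjoinRoot f) D := IsScalarTower.of_algebraMap_smul fun c x => hof c x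
  have : FiniteDimensional (AdjoinRoot f) D := Module.Finite.of_restrictScalars_finite ℚ _ D
  have : CharZero (AdjoinRoot f) := algebraRat.charZero _
  obtain ⟨g, hg⟩ : X - C (AdjoinRoot.root f) ∣ f.map (AdjoinRoot.of f) := by
    rw [dvd_iff_isRoot]
    exact AdjoinRoot.isRoot_root f
  refine not_hasLeftInvariantMean_of_simple_root (r := AdjoinRoot.root f) (g := g) (z := z) σ
    (a := a) (by rw [hroot, one_mul]) (by rwa [hroot]) ?_ ?_ ?_ hmul hj hfrac
  · rw [← hg]
    have : ∀ q : ℚ[X], aeval (LinearMap.mulLeft (AdjoinRoot f) a) (q.map (AdjoinRoot.of f)) =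
        LinearMap.mulLeft (AdjoinRoot f) (aeval a q) := fun q => by
      induction q using Polynomial.induction_on' with
      | add p q hp hq =>
        rw [Polynomial.map_add, map_add, hp, hq, map_add]
        ext x
        simp [add_mul]
      | monomial n c =>
        ext x
        rw [Polynomial.map_monomial, aeval_monomial, aeval_monomial, ← Algebra.smul_def,
          ← Algebra.smul_def, LinearMap.smul_apply, hof, LinearMap.pow_mulLeft,
          LinearMap.mulLeft_apply, LinearMap.mulLeft_apply, smul_mul_assoc]
    rw [this, minpoly.aeval]
    ext x
    simp
  · intro h0
    have hsep := (hirr.separable).map (f := AdjoinRoot.of f)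
    rw [hg, separable_def] at hsep
    obtain ⟨u, w, huw⟩ := hsep
    have := congrArg (eval (AdjoinRoot.root f)) huw
    simp [h0] at this
  · intro δ hδ
    obtain ⟨m, hm⟩ := Padic.rat_dense p r' hδ
    refine ⟨AdjoinRoot.of f m, fun x => ?_, ?_⟩
    · rw [hof, hof, smul_mul_assoc, one_mul]
    · rw [map_sub, hσr]
      simpa using hm

end Nonamenable

section Rationalization

open TensorProduct

/-- Every element of `ℚ ⊗ M` becomes integral after multiplication by a nonzero natural number. -/
theorem TensorProduct.exists_nsmul_eq_one_tmul {M : Type*} [AddCommGroup M] (x : ℚ ⊗[ℤ] M) :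
    ∃ (n : ℕ) (m : M), n ≠ 0 ∧ n • x = 1 ⊗ₜ m := by
  induction x using TensorProduct.induction_on with
  | zero => exact ⟨1, 0, one_ne_zero, by simp⟩
  | tmul q m =>
    refine ⟨q.den, q.num • m, q.den_nz, ?_⟩
    rw [TensorProduct.tmul_smul, TensorProduct.smul_tmul', TensorProduct.smul_tmul']
    congr 1
    rw [nsmul_eq_mul, zsmul_eq_mul, mul_one, mul_comm, Rat.mul_den_eq_num]
  | add x y hx hy =>
    obtain ⟨n, m, hn, h⟩ := hx
    obtain ⟨n', m', hn', h'⟩ := hy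
    refine ⟨n * n', n' • m + n • m', mul_ne_zero hn hn', ?_⟩
    rw [smul_add, mul_smul, smul_comm, h, mul_smul, h', TensorProduct.tmul_add,
      TensorProduct.tmul_smul, TensorProduct.tmul_smul]

namespace ProperMult

variable {d : ℕ} (P : ProperMult d)

/-- Left multiplication on the rationalization. -/
def ratLeft (a : Fin d → ℤ) : Module.End ℚ (ℚ ⊗[ℤ] (Fin d → ℤ)) :=
  (AddMonoidHom.mk' (P.mul a) (P.add_right a)).toIntLinearMap.baseChange ℚ

/-- Right multiplication on the rationalization. -/
def ratRight (b : Fin d → ℤ) : Module.End ℚ (ℚ ⊗[ℤ] (Fin d → ℤ)) :=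
  (AddMonoidHom.mk' (P.mul · b) fun x y => P.add_left x y b).toIntLinearMap.baseChange ℚ

theorem ratLeft_tmul (a : Fin d → ℤ) (q : ℚ) (x : Fin d → ℤ) :
    P.ratLeft a (q ⊗ₜ x) = q ⊗ₜ P.mul a x := rfl

theorem ratRight_tmul (b : Fin d → ℤ) (q : ℚ) (x : Fin d → ℤ) :
    P.ratRight b (q ⊗ₜ x) = q ⊗ₜ P.mul x b := rfl

theorem ratLeft_mul (a b : Fin d → ℤ) : P.ratLeft (P.mul a b) = P.ratLeft a * P.ratLeft b := by
  refine TensorProduct.AlgebraTensorModule.ext fun q x => ?_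
  simp only [Module.End.mul_apply, ratLeft_tmul, P.assoc]

theorem ratRight_mul_ratLeft (a b : Fin d → ℤ) :
    P.ratRight b * P.ratLeft a = P.ratLeft a * P.ratRight b := by
  refine TensorProduct.AlgebraTensorModule.ext fun q x => ?_
  simp only [Module.End.mul_apply, ratLeft_tmul, ratRight_tmul, P.assoc]

theorem ratLeft_surjective {a : Fin d → ℤ} (ha : a ≠ 0) : Function.Surjective (P.ratLeft a) := by
  refine LinearMap.injective_iff_surjective.1 ?_
  refine Module.Flat.lTensor_preserves_injective_linearMap (M := ℚ)
    (AddMonoidHom.mk' (P.mul a) (P.add_right a)).toIntLinearMap ?_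
  refine (injective_iff_map_eq_zero _).2 fun x hx => ?_
  exact (P.no_zero_divisors a x hx).resolve_left ha

theorem ratRight_surjective {b : Fin d → ℤ} (hb : b ≠ 0) :
    Function.Surjective (P.ratRight b) := by
  refine LinearMap.injective_iff_surjective.1 ?_
  refine Module.Flat.lTensor_preserves_injective_linearMap (M := ℚ)
    (AddMonoidHom.mk' (P.mul · b) fun x y => P.add_left x y b).toIntLinearMap ?_
  refine (injective_iff_map_eq_zero _).2 fun x hx => ?_
  exact (P.no_zero_divisors x b hx).resolve_right hb

/-- The endomorphisms of the rationalization commuting with all right multiplications: a division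
algebra in which the left multiplications form a full set of numerators. -/
abbrev divAlg : Subalgebra ℚ (Module.End ℚ (ℚ ⊗[ℤ] (Fin d → ℤ))) :=
  Subalgebra.centralizer ℚ (Set.range P.ratRight)

theorem ratLeft_mem_divAlg (a : Fin d → ℤ) : P.ratLeft a ∈ P.divAlg := by
  rw [Subalgebra.mem_centralizer_iff]
  rintro _ ⟨b, rfl⟩
  exact P.ratRight_mul_ratLeft a b

theorem apply_ratRight {T : Module.End ℚ (ℚ ⊗[ℤ] (Fin d → ℤ))} (hT : T ∈ P.divAlg)
    (b : Fin d → ℤ) (v : ℚ ⊗[ℤ] (Fin d → ℤ)) : T (P.ratRight b v) = P.ratRight b (T v) :=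
  (LinearMap.congr_fun ((Subalgebra.mem_centralizer_iff ℚ).1 hT _ ⟨b, rfl⟩) v).symm

theorem eq_zero_of_apply_eq_zero {T : Module.End ℚ (ℚ ⊗[ℤ] (Fin d → ℤ))} (hT : T ∈ P.divAlg)
    {v : ℚ ⊗[ℤ] (Fin d → ℤ)} (hv : v ≠ 0) (h : T v = 0) : T = 0 := by
  obtain ⟨n, a, hn, hna⟩ := TensorProduct.exists_nsmul_eq_one_tmul v
  have ha : a ≠ 0 := by
    rintro rfl
    rw [TensorProduct.tmul_zero, ← Nat.cast_smul_eq_nsmul ℚ] at hna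
    exact smul_ne_zero (Nat.cast_ne_zero.2 hn) hv hna
  have h1 : T (1 ⊗ₜ a) = 0 := by rw [← hna, map_nsmul, h, smul_zero]
  have h2 : T * P.ratLeft a = 0 := by
    refine TensorProduct.AlgebraTensorModule.ext fun q y => ?_
    have h3 := P.apply_ratRight hT y (q ⊗ₜ a)
    have h4 : q ⊗ₜ[ℤ] a = q • ((1 : ℚ) ⊗ₜ[ℤ] a) := by
      rw [TensorProduct.smul_tmul', smul_eq_mul, mul_one]
    rw [Module.End.mul_apply, ratLeft_tmul, ← ratRight_tmul, h3, h4, map_smul, h1, smul_zero,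
      map_zero]
    rfl
  refine LinearMap.ext fun w => ?_
  obtain ⟨w, rfl⟩ := P.ratLeft_surjective ha w
  exact LinearMap.congr_fun h2 w

theorem one_tmul_injective : Function.Injective fun a : Fin d → ℤ => (1 : ℚ) ⊗ₜ[ℤ] a :=
  Module.Flat.tensorProduct_mk_injective ℤ (Fin d → ℤ) ℚ

theorem one_tmul_ne_zero {a : Fin d → ℤ} (ha : a ≠ 0) : (1 : ℚ) ⊗ₜ[ℤ] a ≠ 0 := fun h =>
  ha (one_tmul_injective (h.trans (TensorProduct.tmul_zero _ _).symm))

theorem ratLeft_ne_zero {a : Fin d → ℤ} (ha : a ≠ 0) : P.ratLeft a ≠ 0 := fun h => by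
  have := LinearMap.congr_fun h (1 ⊗ₜ a)
  rw [ratLeft_tmul] at this
  rcases P.no_zero_divisors a a (by_contra fun h' => one_tmul_ne_zero h' this) with h | h <;>
    exact ha h

theorem ratLeft_zero : P.ratLeft 0 = 0 :=
  TensorProduct.AlgebraTensorModule.ext fun q v => by
    have h0 : P.mul 0 v = 0 := by simpa using P.add_left 0 0 v
    rw [P.ratLeft_tmul, h0, TensorProduct.tmul_zero]
    rfl

theorem ratLeft_injective : Function.Injective P.ratLeft := fun a b h => by
  by_cases hb : b = 0
  · subst hb
    by_contra ha
    exact P.ratLeft_ne_zero ha (h.trans P.ratLeft_zero)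
  · have h1 := LinearMap.congr_fun h (1 ⊗ₜ b)
    rw [P.ratLeft_tmul, P.ratLeft_tmul] at h1
    have h2 : P.mul (a - b) b = 0 := by
      have := P.add_left (a - b) b b
      rwa [sub_add_cancel, one_tmul_injective h1, right_eq_add] at this
    exact sub_eq_zero.1 ((P.no_zero_divisors _ _ h2).resolve_right hb)

theorem exists_ratLeft_eq_nsmul {a : Fin d → ℤ} (ha : a ≠ 0)
    {T : Module.End ℚ (ℚ ⊗[ℤ] (Fin d → ℤ))} (hT : T ∈ P.divAlg) :
    ∃ (n : ℕ) (s : Fin d → ℤ), n ≠ 0 ∧ P.ratLeft s = n • T := by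
  obtain ⟨v, hv⟩ := P.ratRight_surjective ha (T (1 ⊗ₜ a))
  obtain ⟨n, s, hn, hs⟩ := TensorProduct.exists_nsmul_eq_one_tmul v
  refine ⟨n, s, hn, sub_eq_zero.1 ?_⟩
  refine P.eq_zero_of_apply_eq_zero (sub_mem (P.ratLeft_mem_divAlg s) (nsmul_mem hT n))
    (one_tmul_ne_zero ha) ?_
  rw [LinearMap.sub_apply, LinearMap.smul_apply, ← hv, ← map_nsmul, hs, ratLeft_tmul,
    ratRight_tmul, sub_self]

theorem isDomain_divAlg (hd : 0 < d) : IsDomain P.divAlg := by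
  have : Nonempty (Fin d) := ⟨⟨0, hd⟩⟩
  obtain ⟨a, ha⟩ := exists_ne (0 : Fin d → ℤ)
  have : Nontrivial P.divAlg := ⟨⟨⟨_, P.ratLeft_mem_divAlg a⟩, 0, fun h =>
    P.ratLeft_ne_zero ha (congrArg Subtype.val h)⟩⟩
  have : NoZeroDivisors P.divAlg := ⟨fun {S T} h => by
    by_contra! hne
    obtain ⟨v, hv⟩ : ∃ v, T.1 v ≠ 0 := by
      by_contra! hT
      exact hne.2 (Subtype.ext (LinearMap.ext hT))
    exact hne.1 (Subtype.ext (P.eq_zero_of_apply_eq_zero S.2 hv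
      (LinearMap.congr_fun (congrArg Subtype.val h) v)))⟩
  exact NoZeroDivisors.to_isDomain P.divAlg

end ProperMult

end Rationalization

/-- (ℤ^d \ {0}, ∗) is left amenable iff ∗ is commutative on ℤ^d \ {0}. -/
theorem leftAmenable_iff_commutative {d : ℕ} (hd : 0 < d) (P : ProperMult d) :
    HasLeftInvariantMean (pmulNZ P) ↔
      ∀ x y : Fin d → ℤ, x ≠ 0 → y ≠ 0 → P.mul x y = P.mul y x := by
  have : Nonempty (Fin d) := ⟨⟨0, hd⟩⟩
  constructor
  · intro h
    by_contra! hcon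
    obtain ⟨x, y, hx, -, hxy⟩ := hcon
    have := P.isDomain_divAlg hd
    let : DivisionRing P.divAlg := divisionRingOfFiniteDimensional ℚ P.divAlg
    let j : NZ d → P.divAlg := fun s => ⟨P.ratLeft s.1, P.ratLeft_mem_divAlg s.1⟩
    have hj : ∀ s, j s ≠ 0 := fun s h => P.ratLeft_ne_zero s.2 (congrArg Subtype.val h)
    refine not_hasLeftInvariantMean_of_not_commute
      (a := (⟨P.ratLeft x, P.ratLeft_mem_divAlg x⟩ : P.divAlg))
      (z := (⟨P.ratLeft y, P.ratLeft_mem_divAlg y⟩ : P.divAlg)) (fun h => hxy ?_)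
      (fun s t => Subtype.ext (P.ratLeft_mul s.1 t.1)) hj (fun T hT => ?_) h
    · refine P.ratLeft_injective ?_
      rw [P.ratLeft_mul, P.ratLeft_mul]
      exact congrArg Subtype.val h
    · obtain ⟨n, s, hn, hs⟩ := P.exists_ratLeft_eq_nsmul hx T.2
      refine ⟨n, ⟨s, ?_⟩, hn, Subtype.ext hs⟩
      rintro rfl
      rw [P.ratLeft_zero, ← Nat.cast_smul_eq_nsmul ℚ] at hs
      exact hT (Subtype.ext ((smul_eq_zero.1 hs.symm).resolve_left (Nat.cast_ne_zero.2 hn)))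
  · intro hcomm
    obtain ⟨a, ha⟩ := exists_ne (0 : Fin d → ℤ)
    have : Nonempty (NZ d) := ⟨⟨a, ha⟩⟩
    obtain ⟨μ, hμ, hinv⟩ := IsFinAddProb.exists_invariant_of_commute (pmulNZ P) fun s t u =>
      Subtype.ext <| by
        change P.mul s.1 (P.mul t.1 u.1) = P.mul t.1 (P.mul s.1 u.1)
        rw [← P.assoc, hcomm s.1 t.1 s.2 t.2, P.assoc]
    exact ⟨μ, hμ.univ, hμ.nonneg, hμ.union, hinv⟩
end

section
/- Given any collection 𝒜 of proper multiplications on ℤ^d, there exists a set A ⊆ ℤ^d \ {0} that is multiplicatively thick with respect to every multiplication in 𝒜 and is not piecewise syndetic with respect to any proper multiplication ⊙ on ℤ^d that is not aligned with any member of 𝒜. -/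
/-- ∗ and ⊙ are aligned: there are nonzero v, w with x ∗ v ∗ y = x ⊙ w ⊙ y. -/
def Aligned {d : ℕ} (P Q : ProperMult d) : Prop :=
  ∃ v w : Fin d → ℤ, v ≠ 0 ∧ w ≠ 0 ∧
    ∀ x y : Fin d → ℤ, P.mul (P.mul x v) y = Q.mul (Q.mul x w) y

/-- A is multiplicatively (left) thick with respect to P in (ℤ^d\{0}, ∗). -/
def ThickM {d : ℕ} (P : ProperMult d) (A : Set (Fin d → ℤ)) : Prop :=
  ∀ F : Finset (Fin d → ℤ), (∀ f ∈ F, f ≠ 0) →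
    ∃ x : Fin d → ℤ, x ≠ 0 ∧ ∀ f ∈ F, P.mul f x ∈ A

/-- A is multiplicatively (right) syndetic with respect to P in (ℤ^d\{0}, ∗). -/
def SyndM {d : ℕ} (P : ProperMult d) (A : Set (Fin d → ℤ)) : Prop :=
  ∃ F : Finset (Fin d → ℤ), (∀ s ∈ F, s ≠ 0) ∧
    ∀ x : Fin d → ℤ, x ≠ 0 → ∃ s ∈ F, P.mul s x ∈ A

/-- A is multiplicatively piecewise syndetic with respect to P. -/
def PSynM {d : ℕ} (P : ProperMult d) (A : Set (Fin d → ℤ)) : Prop :=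
  ∃ F : Finset (Fin d → ℤ), (∀ s ∈ F, s ≠ 0) ∧
    ThickM P {x : Fin d → ℤ | ∃ s ∈ F, P.mul s x ∈ A}

/-- A is multiplicatively PS* with respect to P: A meets every piecewise
syndetic subset of ℤ^d \ {0}. -/
def PSStarM {d : ℕ} (P : ProperMult d) (A : Set (Fin d → ℤ)) : Prop :=
  ∀ B : Set (Fin d → ℤ), (0 : Fin d → ℤ) ∉ B → PSynM P B → (A ∩ B).Nonempty

section Auxiliary

open Matrix Filter

namespace ProperMult

variable {d : ℕ}

/-- A proper multiplication as a ℤ-bilinear map. -/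
def bilin (P : ProperMult d) :
    (Fin d → ℤ) →ₗ[ℤ] (Fin d → ℤ) →ₗ[ℤ] (Fin d → ℤ) :=
  (AddMonoidHom.mk' (fun x => (AddMonoidHom.mk' (P.mul x) (P.add_right x)).toIntLinearMap)
    (fun x y => LinearMap.ext fun z => P.add_left x y z)).toIntLinearMap

@[simp] lemma bilin_apply (P : ProperMult d) (x y : Fin d → ℤ) : P.bilin x y = P.mul x y := rfl

/-- The matrix of left multiplication. -/
def leftMatrix (P : ProperMult d) : (Fin d → ℤ) →ₗ[ℤ] Matrix (Fin d) (Fin d) ℤ :=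
  LinearMap.toMatrix'.toLinearMap ∘ₗ P.bilin

@[simp] lemma leftMatrix_mulVec (P : ProperMult d) (x y : Fin d → ℤ) :
    P.leftMatrix x *ᵥ y = P.mul x y := by
  simp [leftMatrix, LinearMap.toMatrix'_mulVec]

lemma leftMatrix_mul (P : ProperMult d) (x y : Fin d → ℤ) :
    P.leftMatrix (P.mul x y) = P.leftMatrix x * P.leftMatrix y := by
  refine Matrix.ext_iff_mulVec.mpr fun v => ?_
  simp [← Matrix.mulVec_mulVec, P.assoc]

lemma smul_mul (P : ProperMult d) (k : ℤ) (x y : Fin d → ℤ) :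
    P.mul (k • x) y = k • P.mul x y := by
  rw [← bilin_apply, map_smul, LinearMap.smul_apply, bilin_apply]

lemma mul_smul (P : ProperMult d) (k : ℤ) (x y : Fin d → ℤ) :
    P.mul x (k • y) = k • P.mul x y := by
  rw [← bilin_apply, map_smul, bilin_apply]

lemma mul_ne_zero (P : ProperMult d) {x y : Fin d → ℤ} (hx : x ≠ 0) (hy : y ≠ 0) :
    P.mul x y ≠ 0 := fun h => (P.no_zero_divisors x y h).elim hx hy

lemma mul_left_injective (P : ProperMult d) {x : Fin d → ℤ} (hx : x ≠ 0) :
    Function.Injective (P.mul x) := by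
  intro y z h
  have h0 : P.mul x (y - z) = 0 := by
    rw [← bilin_apply, map_sub, bilin_apply, bilin_apply, h, sub_self]
  exact sub_eq_zero.mp ((P.no_zero_divisors _ _ h0).resolve_left hx)

lemma mul_right_injective (P : ProperMult d) {x : Fin d → ℤ} (hx : x ≠ 0) :
    Function.Injective (fun y => P.mul y x) := by
  intro y z h
  have h0 : P.mul (y - z) x = 0 := by
    rw [← bilin_apply, map_sub, LinearMap.sub_apply, bilin_apply, bilin_apply]
    exact sub_eq_zero.mpr h
  exact sub_eq_zero.mp ((P.no_zero_divisors _ _ h0).resolve_right hx)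

lemma det_leftMatrix_ne_zero (P : ProperMult d) {x : Fin d → ℤ} (hx : x ≠ 0) :
    (P.leftMatrix x).det ≠ 0 := by
  intro h
  obtain ⟨v, hv, hv0⟩ := Matrix.exists_mulVec_eq_zero_iff.mpr h
  rw [leftMatrix_mulVec] at hv0
  exact P.mul_ne_zero hx hv hv0

instance : Countable (ProperMult d) := by
  refine Function.Injective.countable (β := Fin d → Fin d → Fin d → ℤ)
    (f := fun P i j => P.mul (Pi.single i 1) (Pi.single j 1)) fun P Q h => ?_
  have hb : P.bilin = Q.bilin := by
    refine LinearMap.ext_basis (Pi.basisFun ℤ (Fin d)) (Pi.basisFun ℤ (Fin d)) fun i j => ?_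
    simpa using congrFun (congrFun h i) j
  have hm : P.mul = Q.mul := by
    funext x y
    rw [← bilin_apply, hb, bilin_apply]
  cases P; cases Q; cases hm; rfl

end ProperMult

section LinearAlgebra

variable {d : ℕ}

lemma Matrix.mulVec_adjugate_mulVec (M : Matrix (Fin d) (Fin d) ℤ) (y : Fin d → ℤ) :
    M *ᵥ (M.adjugate *ᵥ y) = M.det • y := by
  rw [Matrix.mulVec_mulVec, Matrix.mul_adjugate, Matrix.smul_mulVec, Matrix.one_mulVec]

lemma Matrix.mulVec_injective_of_det_ne_zero' {M : Matrix (Fin d) (Fin d) ℤ} (hM : M.det ≠ 0) :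
    Function.Injective (M *ᵥ ·) := by
  intro x y h
  have h0 : M *ᵥ (x - y) = 0 := by rw [Matrix.mulVec_sub]; exact sub_eq_zero.mpr h
  exact sub_eq_zero.mp (Matrix.eq_zero_of_mulVec_eq_zero hM h0)

/-- Points of the moment curve with positive integer parameter. -/
def momentPoint (d t : ℕ) : Fin d → ℤ := fun i => ((t : ℤ) + 1) ^ ((i : ℕ) + 1)

lemma momentPoint_injective (hd : 0 < d) : Function.Injective (momentPoint d) := by
  intro s t h
  have := congrFun h ⟨0, hd⟩
  simpa [momentPoint] using this

lemma momentPoint_ne_zero (hd : 0 < d) (t : ℕ) : momentPoint d t ≠ 0 := by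
  intro h
  have := congrFun h ⟨0, hd⟩
  simp only [momentPoint, Pi.zero_apply] at this
  have h1 : (0 : ℤ) < ((t : ℤ) + 1) ^ (0 + 1) := by positivity
  omega

lemma det_momentPoint_ne_zero {t : Fin d → ℕ} (ht : Function.Injective t) :
    (Matrix.of fun i => momentPoint d (t i)).det ≠ 0 := by
  have h : (Matrix.of fun i => momentPoint d (t i)) =
      Matrix.diagonal (fun i => ((t i : ℤ) + 1)) *
        Matrix.vandermonde (fun i => ((t i : ℤ) + 1)) := by
    ext i j
    simp [momentPoint, Matrix.diagonal_mul, Matrix.vandermonde, pow_succ']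
  rw [h, Matrix.det_mul, Matrix.det_diagonal]
  refine mul_ne_zero (Finset.prod_ne_zero_iff.mpr fun i _ => by positivity) ?_
  refine Matrix.det_vandermonde_ne_zero_iff.mpr fun i j hij => ht ?_
  simpa using hij

lemma eventually_mulVec_momentPoint_ne_zero {N : Matrix (Fin d) (Fin d) ℤ} (hN : N ≠ 0) :
    ∀ᶠ t in cofinite, N *ᵥ momentPoint d t ≠ 0 := by
  rw [eventually_cofinite]
  by_contra hinf
  simp only [not_not] at hinf
  have hinf : Set.Infinite {t | N *ᵥ momentPoint d t = 0} := hinf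
  have := hinf.to_subtype
  obtain ⟨e⟩ : Nonempty (Fin d ↪ {t | N *ᵥ momentPoint d t = 0}) :=
    ⟨Fin.valEmbedding.trans (Infinite.natEmbedding _)⟩
  apply hN
  ext i j
  have hdet := det_momentPoint_ne_zero
    (t := fun i => (e i : ℕ)) (Subtype.val_injective.comp e.injective)
  have h0 : (Matrix.of fun i => momentPoint d (e i : ℕ)) *ᵥ (N i) = 0 := by
    funext k
    have := congrFun (e k).2 i
    rw [Matrix.mulVec] at this ⊢
    rw [dotProduct_comm]
    exact this
  exact congrFun (Matrix.eq_zero_of_mulVec_eq_zero hdet h0) j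

lemma eventually_mulVec_momentPoint_ne (hd : 0 < d) {M : Matrix (Fin d) (Fin d) ℤ}
    (hM : M.det ≠ 0) (p : Fin d → ℤ) :
    ∀ᶠ t in cofinite, M *ᵥ momentPoint d t ≠ p := by
  rw [eventually_cofinite]
  simp only [not_not]
  exact (Set.finite_singleton p).preimage
    ((Matrix.mulVec_injective_of_det_ne_zero' hM).comp (momentPoint_injective hd)).injOn

end LinearAlgebra

section Alignment

variable {d : ℕ}

/-- Every proper multiplication has a two-sided identity up to a nonzero integer factor. -/
lemma ProperMult.exists_scaled_one (hd : 0 < d) (P : ProperMult d) :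
    ∃ (k : ℤ) (e : Fin d → ℤ), k ≠ 0 ∧ e ≠ 0 ∧
      (∀ x, P.mul e x = k • x) ∧ ∀ x, P.mul x e = k • x := by
  set c := momentPoint d 0
  have hc : c ≠ 0 := momentPoint_ne_zero hd 0
  set k := (P.leftMatrix c).det
  have hk : k ≠ 0 := P.det_leftMatrix_ne_zero hc
  set e := (P.leftMatrix c).adjugate *ᵥ c
  have hce : P.mul c e = k • c := by
    rw [← P.leftMatrix_mulVec]; exact Matrix.mulVec_adjugate_mulVec _ _
  have hl : ∀ x, P.mul e x = k • x := fun x => P.mul_left_injective hc (by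
    rw [← P.assoc, hce, P.smul_mul, P.mul_smul])
  refine ⟨k, e, hk, ?_, hl, fun x => P.mul_right_injective hc ?_⟩
  · intro he
    rw [he, ← P.leftMatrix_mulVec, Matrix.mulVec_zero] at hce
    exact smul_ne_zero hk hc hce.symm
  · simp only [P.assoc, hl, P.mul_smul, P.smul_mul]

/-- Two proper multiplications that associate with each other are aligned. -/
lemma aligned_of_mul_mul_assoc (hd : 0 < d) {P Q : ProperMult d}
    (h : ∀ a u z, P.mul (Q.mul a u) z = Q.mul a (P.mul u z)) : Aligned P Q := by
  obtain ⟨k, e, hk, he, hel, her⟩ := Q.exists_scaled_one hd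
  obtain ⟨k', e', hk', he', hel', her'⟩ := P.exists_scaled_one hd
  have h1 : ∀ a z, k • P.mul a z = Q.mul a (P.mul e z) := fun a z => by
    rw [← h, her, P.smul_mul]
  set m := (Q.leftMatrix e').det
  have hm : m ≠ 0 := Q.det_leftMatrix_ne_zero he'
  set w := (Q.leftMatrix e').adjugate *ᵥ e
  have hw1 : Q.mul e' w = m • e := by
    rw [← Q.leftMatrix_mulVec]; exact Matrix.mulVec_adjugate_mulVec _ _
  have hw0 : w ≠ 0 := by
    intro hw
    rw [hw, ← Q.leftMatrix_mulVec, Matrix.mulVec_zero] at hw1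
    exact smul_ne_zero hm he hw1.symm
  have hw2 : Q.mul w e' = m • e := Q.mul_left_injective he' (by
    rw [← Q.assoc, hw1, Q.smul_mul, hel, Q.mul_smul, her])
  have h2 : ∀ z, k' • Q.mul w z = m • P.mul e z := fun z => by
    have h3 : k • k' • z = Q.mul e' (P.mul e z) := by rw [← h1, hel']
    have h4 := congrArg (Q.mul w) h3
    rw [← Q.assoc, hw2, Q.smul_mul, hel, Q.mul_smul, Q.mul_smul, smul_comm m k] at h4
    exact smul_right_injective _ hk h4
  refine ⟨(m * k) • e', (k' * k') • w, smul_ne_zero (mul_ne_zero hm hk) he',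
    smul_ne_zero (mul_ne_zero hk' hk') hw0, fun x y => ?_⟩
  rw [P.mul_smul, her', P.smul_mul, P.smul_mul, Q.mul_smul, Q.smul_mul, Q.assoc,
    mul_smul m k, smul_comm k k', h1, ← smul_comm k', ← Q.mul_smul m, ← h2, Q.mul_smul, mul_smul]

/-- If, up to scalars, left multiplications of `Q` composed with a fixed nonsingular matrix are
left multiplications of `P`, then `P` and `Q` are aligned. -/
lemma aligned_of_leftMatrix_mul (hd : 0 < d) {P Q : ProperMult d}
    {C : Matrix (Fin d) (Fin d) ℤ} (hC : C.det ≠ 0)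
    (h : ∀ a, ∃ k : ℤ, k ≠ 0 ∧ ∃ g, k • (Q.leftMatrix a * C) = P.leftMatrix g) :
    Aligned P Q := by
  have h1 : ∀ a y z, P.mul (Q.mul a (C *ᵥ y)) z = Q.mul a (C *ᵥ P.mul y z) := by
    intro a y z
    obtain ⟨k, hk, g, hg⟩ := h a
    have h2 : ∀ v, P.mul g v = k • Q.mul a (C *ᵥ v) := fun v => by
      rw [← P.leftMatrix_mulVec, ← hg, Matrix.smul_mulVec, ← Matrix.mulVec_mulVec,
        Q.leftMatrix_mulVec]
    refine smul_right_injective _ hk ?_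
    change k • _ = k • _
    rw [← h2, ← P.smul_mul, ← h2, P.assoc]
  refine aligned_of_mul_mul_assoc hd fun a u z => ?_
  set b := momentPoint d 0
  have hb : b ≠ 0 := momentPoint_ne_zero hd 0
  set M := Q.leftMatrix b * C with hMdef
  have hM : M.det ≠ 0 := by
    rw [hMdef, Matrix.det_mul]
    exact mul_ne_zero (Q.det_leftMatrix_ne_zero hb) hC
  set y := M.adjugate *ᵥ u
  have hy : Q.mul b (C *ᵥ y) = M.det • u := by
    rw [← Q.leftMatrix_mulVec, Matrix.mulVec_mulVec]
    exact Matrix.mulVec_adjugate_mulVec _ _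
  refine smul_right_injective _ hM ?_
  change M.det • _ = M.det • _
  have h3 := h1 (Q.mul a b) y z
  rw [Q.assoc, Q.assoc, ← h1 b, hy] at h3
  simpa only [P.smul_mul, Q.mul_smul] using h3

/-- A variant of `aligned_of_leftMatrix_mul` with the hypothesis checked on moment points only. -/
lemma aligned_of_momentPoint (hd : 0 < d) {P Q : ProperMult d} {s : Fin d → ℤ} (hs : s ≠ 0)
    {C : Matrix (Fin d) (Fin d) ℤ} (hC : C.det ≠ 0) {t : Fin d → ℕ} (ht : Function.Injective t)
    {D : ℤ} (g : Fin d → Fin d → ℤ)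
    (h : ∀ i, Q.leftMatrix (Q.mul s (momentPoint d (t i))) * C = D • P.leftMatrix (g i)) :
    Aligned P Q := by
  refine aligned_of_leftMatrix_mul hd hC fun a => ?_
  set a' := (Q.leftMatrix s).adjugate *ᵥ a
  have ha' : Q.mul s a' = (Q.leftMatrix s).det • a := by
    rw [← Q.leftMatrix_mulVec]; exact Matrix.mulVec_adjugate_mulVec _ _
  set V := (Matrix.of fun i => momentPoint d (t i))ᵀ with hV
  have hVdet : V.det ≠ 0 := by
    rw [hV, Matrix.det_transpose]; exact det_momentPoint_ne_zero ht
  set c := V.adjugate *ᵥ a'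
  have hc : ∑ i, c i • momentPoint d (t i) = V.det • a' := by
    rw [← Matrix.mulVec_adjugate_mulVec]
    funext j
    simp [hV, Matrix.mulVec, dotProduct, c, mul_comm]
  refine ⟨V.det * (Q.leftMatrix s).det, mul_ne_zero hVdet (Q.det_leftMatrix_ne_zero hs),
    D • ∑ i, c i • g i, ?_⟩
  have h1 : (V.det * (Q.leftMatrix s).det) • a =
      ∑ i, c i • Q.mul s (momentPoint d (t i)) := by
    rw [mul_smul, ← ha', ← Q.mul_smul, ← hc, ← Q.bilin_apply, map_sum]
    exact Finset.sum_congr rfl fun i _ => Q.mul_smul _ _ _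
  rw [← Matrix.smul_mul, ← map_smul, h1, map_sum, Finset.sum_mul, map_smul, map_sum,
    Finset.smul_sum]
  refine Finset.sum_congr rfl fun i _ => ?_
  rw [map_smul, Matrix.smul_mul, h i, map_smul, smul_comm]

end Alignment

section Construction

variable {d : ℕ}

/-- `x` is generic relative to the multiplication `P`, the finite set `F` of multipliers, the
finite set `U` of earlier points and the finite set `R` of relations `D u = B u'`. -/
def IsFreshPoint (P : ProperMult d) (F U : Finset (Fin d → ℤ))
    (R : Finset (ℤ × Matrix (Fin d) (Fin d) ℤ)) (x : Fin d → ℤ) : Prop :=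
  x ≠ 0 ∧ ∀ r ∈ R, r.1 ≠ 0 → ∀ g ∈ F,
    (∀ g' ∈ F, r.1 • P.mul g x = r.2 *ᵥ P.mul g' x →
      r.1 • P.leftMatrix g = r.2 * P.leftMatrix g') ∧
    ∀ u ∈ U, r.1 • P.mul g x ≠ r.2 *ᵥ u

lemma exists_isFreshPoint (hd : 0 < d) (P : ProperMult d) (F U : Finset (Fin d → ℤ))
    (hF : ∀ f ∈ F, f ≠ 0) (R : Finset (ℤ × Matrix (Fin d) (Fin d) ℤ)) :
    ∃ x, IsFreshPoint P F U R x := by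
  have h : ∀ᶠ t in cofinite, IsFreshPoint P F U R (momentPoint d t) := by
    refine (Eventually.of_forall (momentPoint_ne_zero hd)).and ?_
    rw [Filter.eventually_all_finset]
    intro r _
    by_cases hr : r.1 = 0
    · simp [hr]
    simp only [ne_eq, hr, not_false_eq_true, forall_const]
    rw [Filter.eventually_all_finset]
    intro g hg
    refine Eventually.and ?_ ?_
    · rw [Filter.eventually_all_finset]
      intro g' _
      by_cases hN : r.1 • P.leftMatrix g - r.2 * P.leftMatrix g' = 0
      · exact Eventually.of_forall fun t _ => sub_eq_zero.mp hN
      · filter_upwards [eventually_mulVec_momentPoint_ne_zero hN] with t ht h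
        refine absurd ?_ ht
        rw [Matrix.sub_mulVec, Matrix.smul_mulVec, ← Matrix.mulVec_mulVec,
          P.leftMatrix_mulVec, P.leftMatrix_mulVec, h, sub_self]
    · rw [Filter.eventually_all_finset]
      intro u _
      have hdet : (r.1 • P.leftMatrix g).det ≠ 0 := by
        rw [Matrix.det_smul]
        exact mul_ne_zero (pow_ne_zero _ hr) (P.det_leftMatrix_ne_zero (hF g hg))
      filter_upwards [eventually_mulVec_momentPoint_ne hd hdet (r.2 *ᵥ u)] with t ht
      rwa [Matrix.smul_mulVec, P.leftMatrix_mulVec] at ht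
  obtain ⟨t, ht⟩ := h.exists
  exact ⟨_, ht⟩

/-- Generic points can be chosen successively, each relative to all the blocks before it. -/
lemma exists_seq_isFreshPoint (hd : 0 < d) (P : ℕ → ProperMult d)
    (F : ℕ → Finset (Fin d → ℤ)) (hF : ∀ n, ∀ f ∈ F n, f ≠ 0)
    (R : ℕ → Finset (ℤ × Matrix (Fin d) (Fin d) ℤ)) :
    ∃ (x : ℕ → Fin d → ℤ) (U : ℕ → Finset (Fin d → ℤ)),
      (∀ n, IsFreshPoint (P n) (F n) (U n) (R n) (x n)) ∧
      ∀ m n, m < n → ∀ f ∈ F m, (P m).mul f (x m) ∈ U n := by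
  classical
  choose X hX using fun n U => exists_isFreshPoint hd (P n) (F n) U (hF n) (R n)
  let U : ℕ → Finset (Fin d → ℤ) := fun n => Nat.rec ∅
    (fun n V => V ∪ (F n).image fun f => (P n).mul f (X n V)) n
  have hU : ∀ n, U (n + 1) = U n ∪ (F n).image fun f => (P n).mul f (X n (U n)) := fun n => rfl
  refine ⟨fun n => X n (U n), U, fun n => hX n _, fun m n hmn f hf => ?_⟩
  have hmono : Monotone U := monotone_nat_of_le_succ fun n => by
    rw [hU]; exact Finset.subset_union_left
  refine hmono (Nat.succ_le_of_lt hmn) ?_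
  rw [Nat.succ_eq_add_one, hU]
  exact Finset.mem_union_right _ (Finset.mem_image_of_mem _ hf)

/-- A thick set contains translates of any given finite set by elements outside any given
finite set. -/
lemma ThickM.exists_notMem (hd : 0 < d) {Q : ProperMult d} {T : Set (Fin d → ℤ)}
    (hT : ThickM Q T) (F : Finset (Fin d → ℤ)) (hF : ∀ f ∈ F, f ≠ 0)
    (B : Finset (Fin d → ℤ)) :
    ∃ x ∉ B, x ≠ 0 ∧ ∀ f ∈ F, Q.mul f x ∈ T := by
  classical
  set Y := (Finset.range (B.card + 1)).image (momentPoint d) with hY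
  have hYcard : Y.card = B.card + 1 := by
    rw [hY, Finset.card_image_of_injective _ (momentPoint_injective hd), Finset.card_range]
  have hY0 : ∀ y ∈ Y, y ≠ 0 := by
    intro y hy
    obtain ⟨t, _, rfl⟩ := Finset.mem_image.mp hy
    exact momentPoint_ne_zero hd t
  obtain ⟨x, hx, hxT⟩ := hT (Finset.image₂ Q.mul F Y) (by
    intro v hv
    obtain ⟨f, hf, y, hy, rfl⟩ := Finset.mem_image₂.mp hv
    exact Q.mul_ne_zero (hF f hf) (hY0 y hy))
  obtain ⟨v, hv, hvB⟩ := Finset.exists_mem_notMem_of_card_lt_card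
    (s := B) (t := Y.image fun y => Q.mul y x) (by
      rw [Finset.card_image_of_injective _ (Q.mul_right_injective hx)]; omega)
  obtain ⟨y, hy, rfl⟩ := Finset.mem_image.mp hv
  refine ⟨_, hvB, Q.mul_ne_zero (hY0 y hy) hx, fun f hf => ?_⟩
  rw [← Q.assoc]
  exact hxT _ (Finset.mem_image₂_of_mem hf hy)

/-- If the union of the blocks is piecewise syndetic for `Q`, then `Q` is aligned with one of
the multiplications used in the blocks. -/
lemma exists_aligned_of_pSynM (hd : 0 < d) {P : ℕ → ProperMult d}
    {F U : ℕ → Finset (Fin d → ℤ)} (hF : ∀ n, ∀ f ∈ F n, f ≠ 0)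
    {R : ℕ → Finset (ℤ × Matrix (Fin d) (Fin d) ℤ)}
    (hR : ∀ r, ∀ᶠ n in atTop, r ∈ R n) {x : ℕ → Fin d → ℤ}
    (hx : ∀ n, IsFreshPoint (P n) (F n) (U n) (R n) (x n))
    (hU : ∀ m n, m < n → ∀ f ∈ F m, (P m).mul f (x m) ∈ U n) {Q : ProperMult d}
    (hQ : PSynM Q {a | ∃ n, ∃ f ∈ F n, a = (P n).mul f (x n)}) : ∃ n, Aligned (P n) Q := by
  classical
  obtain ⟨S, hS, hT⟩ := hQ
  set K := Finset.range (S.card * d + 1) with hK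
  set E := Finset.image₂ Q.mul S (K.image (momentPoint d))
  have hE0 : ∀ a ∈ E, a ≠ 0 := by
    intro a ha
    obtain ⟨s, hs, f, hf, rfl⟩ := Finset.mem_image₂.mp ha
    obtain ⟨t, _, rfl⟩ := Finset.mem_image.mp hf
    exact Q.mul_ne_zero (hS s hs) (momentPoint_ne_zero hd t)
  obtain ⟨N, hN⟩ : ∃ N, ∀ n ≥ N, ∀ a ∈ E, ∀ b ∈ E,
      ((Q.leftMatrix b).det, Q.leftMatrix a * (Q.leftMatrix b).adjugate) ∈ R n := by
    rw [← Filter.eventually_atTop, Filter.eventually_all_finset]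
    intro a _
    rw [Filter.eventually_all_finset]
    intro b _
    exact hR _
  have hbad : {y | ∃ a ∈ E, Q.mul a y ∈ U N}.Finite := by
    have : {y | ∃ a ∈ E, Q.mul a y ∈ U N} = ⋃ a ∈ E, Q.mul a ⁻¹' (U N) := by
      ext y; simp
    rw [this]
    exact E.finite_toSet.biUnion fun a ha =>
      (U N).finite_toSet.preimage (Q.mul_left_injective (hE0 a ha)).injOn
  obtain ⟨y, hyB, hy0, hyT⟩ := hT.exists_notMem hd (K.image (momentPoint d)) (by
    intro f hf
    obtain ⟨t, _, rfl⟩ := Finset.mem_image.mp hf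
    exact momentPoint_ne_zero hd t) hbad.toFinset
  simp only [Set.Finite.mem_toFinset, Set.mem_ofPred_eq, not_exists, not_and] at hyB
  have hyT' : ∀ t ∈ K, ∃ s ∈ S, ∃ n, ∃ f ∈ F n,
      Q.mul s (Q.mul (momentPoint d t) y) = (P n).mul f (x n) :=
    fun t ht => hyT _ (Finset.mem_image_of_mem _ ht)
  choose! σ hσ blk g hg heq using hyT'
  have hmemE : ∀ t ∈ K, Q.mul (σ t) (momentPoint d t) ∈ E := fun t ht =>
    Finset.mem_image₂_of_mem (hσ t ht) (Finset.mem_image_of_mem _ ht)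
  have heq' : ∀ t ∈ K, Q.mul (Q.mul (σ t) (momentPoint d t)) y =
      (P (blk t)).mul (g t) (x (blk t)) :=
    fun t ht => by rw [Q.assoc, heq t ht]
  have hblkN : ∀ t ∈ K, N ≤ blk t := by
    intro t ht
    by_contra hlt
    refine hyB _ (hmemE t ht) ?_
    rw [heq' t ht]
    exact hU _ _ (not_le.mp hlt) _ (hg t ht)
  have hrel : ∀ a b : Fin d → ℤ, (Q.leftMatrix b).det • Q.mul a y =
      (Q.leftMatrix a * (Q.leftMatrix b).adjugate) *ᵥ Q.mul b y := by
    intro a b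
    rw [← Q.leftMatrix_mulVec b, Matrix.mulVec_mulVec, Matrix.mul_assoc, Matrix.adjugate_mul,
      Matrix.mul_smul, Matrix.mul_one, Matrix.smul_mulVec, Q.leftMatrix_mulVec]
  have hle : ∀ t ∈ K, ∀ t' ∈ K, blk t ≤ blk t' := by
    intro t ht t' ht'
    by_contra hlt
    have h1 := ((hx (blk t)).2 _ (hN _ (hblkN t ht) _ (hmemE t ht) _ (hmemE t' ht'))
      (Q.det_leftMatrix_ne_zero (hE0 _ (hmemE t' ht'))) (g t) (hg t ht)).2 _
      (hU _ _ (not_le.mp hlt) _ (hg t' ht'))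
    rw [← heq' t ht, ← heq' t' ht'] at h1
    exact h1 (hrel _ _)
  obtain ⟨s, hs, hfib⟩ := Finset.exists_lt_card_fiber_of_mul_lt_card_of_maps_to
    (s := K) (t := S) (f := σ) (n := d) hσ (by rw [hK, Finset.card_range]; omega)
  set T := K.filter fun t => σ t = s with hTdef
  have hTK : ∀ t ∈ T, t ∈ K ∧ σ t = s := fun t ht => Finset.mem_filter.mp ht
  obtain ⟨t₀, ht₀⟩ : T.Nonempty := Finset.card_pos.mp (by omega)
  obtain ⟨e⟩ : Nonempty (Fin d ↪ T) := by
    rw [Function.Embedding.nonempty_iff_card_le]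
    simpa using hfib.le
  set n := blk t₀
  have hblk : ∀ t ∈ T, blk t = n := fun t ht =>
    le_antisymm (hle _ (hTK t ht).1 _ (hTK t₀ ht₀).1) (hle _ (hTK t₀ ht₀).1 _ (hTK t ht).1)
  have hb := hE0 _ (hmemE t₀ (hTK t₀ ht₀).1)
  set b := Q.mul (σ t₀) (momentPoint d t₀)
  have hg₀ : g t₀ ≠ 0 := hF _ _ (hg t₀ (hTK t₀ ht₀).1)
  refine ⟨n, aligned_of_momentPoint hd (hS s hs)
    (C := (Q.leftMatrix b).adjugate * (P n).leftMatrix (g t₀)) ?_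
    (t := fun i => (e i : ℕ)) (Subtype.val_injective.comp e.injective)
    (D := (Q.leftMatrix b).det) (fun i => g (e i)) fun i => ?_⟩
  · rw [Matrix.det_mul, Matrix.det_adjugate]
    exact mul_ne_zero (pow_ne_zero _ (Q.det_leftMatrix_ne_zero hb))
      ((P n).det_leftMatrix_ne_zero hg₀)
  · obtain ⟨hiK, his⟩ := hTK _ (e i).2
    have hbi := hblk _ (e i).2
    have hgi := hg _ hiK
    have hqi := heq' _ hiK
    have hNi := hmemE _ hiK
    rw [hbi] at hgi hqi
    rw [his] at hqi hNi
    rw [← Matrix.mul_assoc]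
    refine (((hx n).2 _ (hN n (hblkN _ (hTK t₀ ht₀).1) _ hNi b (hmemE _ (hTK t₀ ht₀).1))
      (Q.det_leftMatrix_ne_zero hb) _ hgi).1 (g t₀) (hg t₀ (hTK t₀ ht₀).1) ?_).symm
    rw [← hqi, ← heq' t₀ (hTK t₀ ht₀).1]
    exact hrel _ _

/-- A countable type is exhausted by an increasing sequence of finite sets. -/
lemma exists_seq_finset_eventually_mem (α : Type*) [Countable α] :
    ∃ E : ℕ → Finset α, ∀ a, ∃ k, ∀ n ≥ k, a ∈ E n := by
  classical
  obtain ⟨f, hf⟩ := Countable.exists_injective_nat α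
  refine ⟨fun n => ((Set.finite_Iio n).preimage hf.injOn).toFinset, fun a => ⟨f a + 1, ?_⟩⟩
  intro n hn
  simp only [Set.Finite.mem_toFinset, Set.mem_preimage, Set.mem_Iio]
  omega

end Construction

end Auxiliary

/-- For any collection 𝒜 of proper multiplications on ℤ^d there is a set
A ⊆ ℤ^d \ {0} which is thick with respect to every member of 𝒜 and not
piecewise syndetic with respect to any proper multiplication not aligned with
any member of 𝒜. -/
theorem exists_thick_not_piecewiseSyndetic {d : ℕ} (hd : 0 < d)
    (𝒜 : Set (ProperMult d)) :
    ∃ A : Set (Fin d → ℤ), (∀ a ∈ A, a ≠ (0 : Fin d → ℤ)) ∧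
      (∀ P ∈ 𝒜, ThickM P A) ∧
      ∀ Q : ProperMult d, (∀ P ∈ 𝒜, ¬ Aligned P Q) → ¬ PSynM Q A := by
  classical
  rcases 𝒜.eq_empty_or_nonempty with rfl | hne
  · refine ⟨∅, by simp, by simp, ?_⟩
    rintro Q - ⟨S, -, hT⟩
    obtain ⟨x, -, hx⟩ := hT {momentPoint d 0} (by simpa using momentPoint_ne_zero hd 0)
    simpa using hx _ (Finset.mem_singleton_self _)
  · have := hne.to_subtype
    obtain ⟨p, hp⟩ := exists_surjective_nat 𝒜
    obtain ⟨E, hE⟩ := exists_seq_finset_eventually_mem (Fin d → ℤ)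
    have : Countable (Matrix (Fin d) (Fin d) ℤ) :=
      inferInstanceAs (Countable (Fin d → Fin d → ℤ))
    obtain ⟨R, hR⟩ := exists_seq_finset_eventually_mem (ℤ × Matrix (Fin d) (Fin d) ℤ)
    let P : ℕ → ProperMult d := fun n => p n.unpair.1
    let F : ℕ → Finset (Fin d → ℤ) := fun n => (E n).filter (· ≠ 0)
    have hF : ∀ n, ∀ f ∈ F n, f ≠ 0 := fun n f hf => (Finset.mem_filter.mp hf).2
    obtain ⟨x, U, hx, hU⟩ := exists_seq_isFreshPoint hd P F hF R
    refine ⟨{a | ∃ n, ∃ f ∈ F n, a = (P n).mul f (x n)}, ?_, ?_, ?_⟩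
    · rintro a ⟨n, f, hf, rfl⟩
      exact (P n).mul_ne_zero (hF n f hf) (hx n).1
    · intro Q hQ G hG
      obtain ⟨i, hi⟩ := hp ⟨Q, hQ⟩
      have hEG : ∀ᶠ n in Filter.atTop, ∀ f ∈ G, f ∈ E n := by
        rw [Filter.eventually_all_finset]
        exact fun f _ => Filter.eventually_atTop.mpr (hE f)
      obtain ⟨k, hk⟩ := Filter.eventually_atTop.mp hEG
      have hPn : P (Nat.pair i k) = Q := by simp [P, hi]
      refine ⟨x (Nat.pair i k), (hx _).1, fun f hf => ⟨Nat.pair i k, f, ?_, by rw [hPn]⟩⟩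
      exact Finset.mem_filter.mpr ⟨hk _ (Nat.right_le_pair i k) f hf, hG f hf⟩
    · intro Q hQ hsyn
      obtain ⟨n, hn⟩ := exists_aligned_of_pSynM hd hF
        (fun r => Filter.eventually_atTop.mpr (hR r)) hx hU hsyn
      exact hQ _ (p _).2 hn
end
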